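/- Suppose the linear operators 𝒜₁,…,𝒜ₛ : ℝ^{n×n} → ℝ^m satisfy the ARIP at rank 2r with parameter δ₂ᵣ and at rank 3r with parameter δ₃ᵣ, where δ₂ᵣ ≤ δ₃ᵣ < 1 and γ₁ := 4δ₃ᵣ/(1−δ₃ᵣ) < 1. Let X₁,…,Xₛ ∈ ℝ^{n×n} have rank at most r, let e ∈ ℝ^m, and let y = Σ_{k=1}^s 𝒜_k(X_k) + e. Suppose the sequences (X_{k,l})_{l≥0} of rank-r matrices satisfy the IHT recursion: r_l = y − Σ_k 𝒜_k(X_{k,l}), G_{k,l} = 𝒜_k^*(r_l), α_{k,l} = ‖P_{T_{k,l}}(G_{k,l})‖_F² / ‖𝒜_k(P_{T_{k,l}}(G_{k,l}))‖² (with P_{T_{k,l}}(G_{k,l}) ≠ 0), and X_{k,l+1} is a best rank-r approximation of X_{k,l} + α_{k,l} G_{k,l}. Then for every l ≥ 0, √(Σ_{k=1}^s ‖X_{k,l} − X_k‖_F²) ≤ γ₁^l · √(Σ_{k=1}^s ‖X_{k,0} − X_k‖_F²) + (ξ/(1−γ₁))·‖e‖, where ξ = 2√(1+δ₃ᵣ)/(1−δ₂ᵣ).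 -/

import Mathlib

open Matrix MeasureTheory ProbabilityTheory Finset

noncomputable section

/-- Frobenius inner product on square real matrices: `⟨X,Y⟩ = trace (Xᵀ Y)`. -/
def finner {n : ℕ} (X Y : Matrix (Fin n) (Fin n) ℝ) : ℝ := (Xᵀ * Y).trace

/-- Frobenius norm. -/
def fnorm {n : ℕ} (X : Matrix (Fin n) (Fin n) ℝ) : ℝ := Real.sqrt (finner X X)

/-- Euclidean norm on `ℝ^m`. -/
def enorm2 {m : ℕ} (v : Fin m → ℝ) : ℝ := Real.sqrt (∑ p, (v p) ^ 2)

/-- The linear operator `𝒜` associated with measurement matrices `A_p`: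
`(𝒜 Z)_p = (1/√m) ⟨A_p, Z⟩`. -/
def opA {n m : ℕ} (A : Fin m → Matrix (Fin n) (Fin n) ℝ)
    (Z : Matrix (Fin n) (Fin n) ℝ) : Fin m → ℝ :=
  fun p => (1 / Real.sqrt m) * finner (A p) Z

/-- The adjoint operator `𝒜^* v = (1/√m) Σ_p v_p A_p`. -/
def adjA {n m : ℕ} (A : Fin m → Matrix (Fin n) (Fin n) ℝ)
    (v : Fin m → ℝ) : Matrix (Fin n) (Fin n) ℝ :=
  (1 / Real.sqrt m) • ∑ p, v p • A p

/-- Amalgam restricted isometry property at rank `r` with parameter `δ`. -/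
def ARIP {n m s : ℕ} (𝒜 : Fin s → Matrix (Fin n) (Fin n) ℝ → (Fin m → ℝ))
    (r : ℕ) (δ : ℝ) : Prop :=
  ∀ Z : Fin s → Matrix (Fin n) (Fin n) ℝ, (∀ k, (Z k).rank ≤ r) →
    (1 - δ) * ∑ k, fnorm (Z k) ^ 2 ≤ enorm2 (∑ k, 𝒜 k (Z k)) ^ 2 ∧
    enorm2 (∑ k, 𝒜 k (Z k)) ^ 2 ≤ (1 + δ) * ∑ k, fnorm (Z k) ^ 2

/-- Orthogonal projection onto the tangent space determined by the SVD factors `U`, `V`: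
`P_T(G) = UUᵀG + GVVᵀ − UUᵀGVVᵀ`. -/
def Pt {n r : ℕ} (U V : Matrix (Fin n) (Fin r) ℝ)
    (G : Matrix (Fin n) (Fin n) ℝ) : Matrix (Fin n) (Fin n) ℝ :=
  U * Uᵀ * G + G * (V * Vᵀ) - U * Uᵀ * G * (V * Vᵀ)

/-- `X'` is a best rank-`r` approximation of `W` in Frobenius norm. -/
def IsBestRankApprox {n : ℕ} (r : ℕ) (W X' : Matrix (Fin n) (Fin n) ℝ) : Prop :=
  X'.rank ≤ r ∧ ∀ Z : Matrix (Fin n) (Fin n) ℝ, Z.rank ≤ r → fnorm (X' - W) ≤ fnorm (Z - W)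

lemma finner_eq {n : ℕ} (X Y : Matrix (Fin n) (Fin n) ℝ) :
    finner X Y = ∑ i, ∑ j, X i j * Y i j := by
  rw [Finset.sum_comm]
  simp [finner, Matrix.trace, Matrix.mul_apply]

lemma finner_self_nonneg {n : ℕ} (X : Matrix (Fin n) (Fin n) ℝ) : 0 ≤ finner X X := by
  rw [finner_eq]
  exact Finset.sum_nonneg fun i _ => Finset.sum_nonneg fun j _ => mul_self_nonneg _

lemma fnorm_sq {n : ℕ} (X : Matrix (Fin n) (Fin n) ℝ) : fnorm X ^ 2 = finner X X :=
  Real.sq_sqrt (finner_self_nonneg X)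

lemma fnorm_sq_pos {n : ℕ} {X : Matrix (Fin n) (Fin n) ℝ} (h : X ≠ 0) : 0 < fnorm X ^ 2 := by
  rw [fnorm_sq]
  refine lt_of_le_of_ne (finner_self_nonneg X) fun h0 => h ?_
  rw [finner_eq] at h0
  have h1 := (Finset.sum_eq_zero_iff_of_nonneg (fun i _ =>
    Finset.sum_nonneg fun j _ => mul_self_nonneg (X i j))).1 h0.symm
  ext i j
  have h2 := (Finset.sum_eq_zero_iff_of_nonneg (fun j _ => mul_self_nonneg (X i j))).1
    (h1 i (Finset.mem_univ i)) j (Finset.mem_univ j)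
  simpa using h2

/-- pack a family of matrices in a Euclidean space -/
def toH {s n : ℕ} (Z : Fin s → Matrix (Fin n) (Fin n) ℝ) :
    EuclideanSpace ℝ (Fin s × Fin n × Fin n) :=
  WithLp.toLp 2 fun q => Z q.1 q.2.1 q.2.2

lemma toH_inner {s n : ℕ} (Z W : Fin s → Matrix (Fin n) (Fin n) ℝ) :
    inner ℝ (toH Z) (toH W) = ∑ k, finner (Z k) (W k) := by
  simp [toH, PiLp.inner_apply, Fintype.sum_prod_type, finner_eq, mul_comm]

lemma toH_norm_sq {s n : ℕ} (Z : Fin s → Matrix (Fin n) (Fin n) ℝ) :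
    ‖toH Z‖ ^ 2 = ∑ k, fnorm (Z k) ^ 2 := by
  rw [← real_inner_self_eq_norm_sq, toH_inner]
  simp [fnorm_sq]

lemma toH_norm {s n : ℕ} (Z : Fin s → Matrix (Fin n) (Fin n) ℝ) :
    ‖toH Z‖ = Real.sqrt (∑ k, fnorm (Z k) ^ 2) := by
  rw [← toH_norm_sq, Real.sqrt_sq (norm_nonneg _)]

/-- pack a vector -/
def toM {m : ℕ} (v : Fin m → ℝ) : EuclideanSpace ℝ (Fin m) := WithLp.toLp 2 v

lemma toM_norm {m : ℕ} (v : Fin m → ℝ) : ‖toM v‖ = enorm2 v := by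
  simp [toM, enorm2, EuclideanSpace.norm_eq]

/-- the amalgamated operator -/
def bigL {n m s : ℕ} (A : Fin s → Fin m → Matrix (Fin n) (Fin n) ℝ)
    (Z : Fin s → Matrix (Fin n) (Fin n) ℝ) : EuclideanSpace ℝ (Fin m) :=
  toM (∑ k, opA (A k) (Z k))

lemma finner_add_right {n : ℕ} (X Y Z : Matrix (Fin n) (Fin n) ℝ) :
    finner X (Y + Z) = finner X Y + finner X Z := by
  simp [finner, Matrix.mul_add]

lemma finner_smul_right {n : ℕ} (c : ℝ) (X Y : Matrix (Fin n) (Fin n) ℝ) :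
    finner X (c • Y) = c * finner X Y := by
  simp [finner]

lemma finner_comm {n : ℕ} (X Y : Matrix (Fin n) (Fin n) ℝ) :
    finner X Y = finner Y X := by
  simp [finner_eq, mul_comm]

lemma finner_sum_right {n : ℕ} {ι : Type*} (t : Finset ι) (X : Matrix (Fin n) (Fin n) ℝ)
    (Y : ι → Matrix (Fin n) (Fin n) ℝ) :
    finner X (∑ i ∈ t, Y i) = ∑ i ∈ t, finner X (Y i) := by
  simp [finner, Matrix.mul_sum, Matrix.trace_sum]

lemma opA_add {n m : ℕ} (A : Fin m → Matrix (Fin n) (Fin n) ℝ) (X Y) :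
    opA A (X + Y) = opA A X + opA A Y := by
  ext p; simp [opA, finner_add_right, mul_add]

lemma opA_smul {n m : ℕ} (A : Fin m → Matrix (Fin n) (Fin n) ℝ) (c : ℝ) (X) :
    opA A (c • X) = c • opA A X := by
  ext p; simp [opA, finner_smul_right]; ring

lemma opA_zero {n m : ℕ} (A : Fin m → Matrix (Fin n) (Fin n) ℝ) :
    opA A 0 = 0 := by
  ext p; simp [opA, finner]

lemma toH_comb {s n : ℕ} (a b : ℝ) (Z W : Fin s → Matrix (Fin n) (Fin n) ℝ) :
    toH (fun k => a • Z k + b • W k) = a • toH Z + b • toH W := by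
  ext q; simp [toH]

lemma bigL_comb {n m s : ℕ} (A : Fin s → Fin m → Matrix (Fin n) (Fin n) ℝ) (a b : ℝ)
    (Z W : Fin s → Matrix (Fin n) (Fin n) ℝ) :
    bigL A (fun k => a • Z k + b • W k) = a • bigL A Z + b • bigL A W := by
  ext p
  simp [bigL, toM, opA_add, opA_smul, Finset.sum_add_distrib, Finset.mul_sum]

lemma adj_inner {n m : ℕ} (A : Fin m → Matrix (Fin n) (Fin n) ℝ)
    (X : Matrix (Fin n) (Fin n) ℝ) (v : Fin m → ℝ) :
    finner X (adjA A v) = ∑ p, opA A X p * v p := by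
  simp only [adjA, finner_smul_right, finner_sum_right, opA, Finset.mul_sum]
  refine Finset.sum_congr rfl fun p _ => ?_
  rw [finner_comm X]; ring

lemma bigL_inner {n m s : ℕ} (A : Fin s → Fin m → Matrix (Fin n) (Fin n) ℝ)
    (Z : Fin s → Matrix (Fin n) (Fin n) ℝ) (v : Fin m → ℝ) :
    inner ℝ (bigL A Z) (toM v) = ∑ k, finner (Z k) (adjA (A k) v) := by
  simp only [adj_inner]
  rw [Finset.sum_comm]
  simp [bigL, toM, PiLp.inner_apply, Finset.sum_mul, mul_comm, Finset.mul_sum]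

lemma rank_smul_le' {n : ℕ} (c : ℝ) (X : Matrix (Fin n) (Fin n) ℝ) :
    (c • X).rank ≤ X.rank := by
  have : c • X = (c • (1 : Matrix (Fin n) (Fin n) ℝ)) * X := by simp
  rw [this]
  exact Matrix.rank_mul_le_right _ _

lemma mrank_add_le {n : ℕ} (X Y : Matrix (Fin n) (Fin n) ℝ) :
    (X + Y).rank ≤ X.rank + Y.rank := by
  unfold Matrix.rank
  refine le_trans (Submodule.finrank_mono (t := LinearMap.range X.mulVecLin ⊔
    LinearMap.range Y.mulVecLin) ?_) (Submodule.finrank_add_le_finrank_add_finrank _ _)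
  rw [Matrix.mulVecLin_add]
  exact LinearMap.range_add_le _ _

lemma Pt_rank {n r : ℕ} (U V : Matrix (Fin n) (Fin r) ℝ) (G : Matrix (Fin n) (Fin n) ℝ) :
    (Pt U V G).rank ≤ 2 * r := by
  have : Pt U V G = U * (Uᵀ * G) + (G - U * Uᵀ * G) * V * Vᵀ := by
    simp only [Pt, Matrix.sub_mul, Matrix.mul_assoc]; abel
  rw [this]
  refine (mrank_add_le _ _).trans ?_
  have h1 := (Matrix.rank_mul_le_left U (Uᵀ * G)).trans (Matrix.rank_le_width U)
  have h2 := (Matrix.rank_mul_le_right ((G - U * Uᵀ * G) * V) Vᵀ).trans (Matrix.rank_le_height Vᵀ)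
  omega

/-- bilinear RIP -/
lemma bilin_rip {n m s : ℕ} (A : Fin s → Fin m → Matrix (Fin n) (Fin n) ℝ) (δ : ℝ) (hδ : 0 ≤ δ)
    (F E : Fin s → Matrix (Fin n) (Fin n) ℝ)
    (h : ∀ a b : ℝ, |‖bigL A (fun k => a • F k + b • E k)‖ ^ 2
      - ‖toH (fun k => a • F k + b • E k)‖ ^ 2| ≤ δ * ‖toH (fun k => a • F k + b • E k)‖ ^ 2) :
    |inner ℝ (bigL A F) (bigL A E) - inner ℝ (toH F) (toH E)| ≤ δ * (‖toH F‖ * ‖toH E‖) := by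
  set b := inner ℝ (bigL A F) (bigL A E) - inner ℝ (toH F) (toH E) with hb
  have key : ∀ t : ℝ, 0 ≤ (δ * ‖toH F‖ ^ 2) * (t * t) + (-2 * b) * t + δ * ‖toH E‖ ^ 2 := by
    intro t
    have h1 := (abs_le.1 (h t 1)).2
    have h2 := (abs_le.1 (h t (-1))).1
    simp only [bigL_comb, toH_comb, ← real_inner_self_eq_norm_sq, inner_add_left, inner_add_right,
      inner_smul_left, inner_smul_right, real_inner_comm (bigL A F) (bigL A E),
      real_inner_comm (toH F) (toH E)] at h1 h2 ⊢
    simp at h1 h2 ⊢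
    rw [hb]
    nlinarith
  have hd := discrim_le_zero key
  rw [discrim] at hd
  apply abs_le_of_sq_le_sq _ (by positivity)
  nlinarith

lemma arip_abs {n m s r : ℕ} {A : Fin s → Fin m → Matrix (Fin n) (Fin n) ℝ} {δ : ℝ}
    (h : ARIP (fun k => opA (A k)) r δ) (Z : Fin s → Matrix (Fin n) (Fin n) ℝ)
    (hZ : ∀ k, (Z k).rank ≤ r) :
    |‖bigL A Z‖ ^ 2 - ‖toH Z‖ ^ 2| ≤ δ * ‖toH Z‖ ^ 2 := by
  obtain ⟨h1, h2⟩ := h Z hZ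
  rw [toH_norm_sq, bigL, toM_norm, abs_le]
  constructor <;> linarith

lemma arip_single {n m s r : ℕ} {A : Fin s → Fin m → Matrix (Fin n) (Fin n) ℝ} {δ : ℝ}
    (h : ARIP (fun k => opA (A k)) r δ) (k : Fin s) (P : Matrix (Fin n) (Fin n) ℝ)
    (hP : P.rank ≤ r) :
    (1 - δ) * fnorm P ^ 2 ≤ enorm2 (opA (A k) P) ^ 2 ∧
    enorm2 (opA (A k) P) ^ 2 ≤ (1 + δ) * fnorm P ^ 2 := by
  have h1 := h (fun j => if j = k then P else 0) (by
    intro j; by_cases hj : j = k <;> simp [hj, hP])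
  have e1 : ∑ j, fnorm (if j = k then P else 0) ^ 2 = fnorm P ^ 2 := by
    rw [Finset.sum_eq_single k]
    · simp
    · intro j _ hj; simp [hj, fnorm_sq, finner]
    · simp
  have e2 : ∑ j, opA (A j) (if j = k then P else 0) = opA (A k) P := by
    rw [Finset.sum_eq_single k]
    · simp
    · intro j _ hj; simp [hj, opA_zero]
    · simp
  simp only [e1, e2] at h1
  exact h1

lemma toH_mono {s n : ℕ} (c : ℝ) (hc : 0 ≤ c) (a : Fin s → ℝ) (ha : ∀ k, |a k| ≤ c)
    (Z : Fin s → Matrix (Fin n) (Fin n) ℝ) :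
    ‖toH (fun k => a k • Z k)‖ ≤ c * ‖toH Z‖ := by
  apply le_of_sq_le_sq _ (by positivity)
  rw [mul_pow, toH_norm_sq, toH_norm_sq, Finset.mul_sum]
  refine Finset.sum_le_sum fun k _ => ?_
  have : fnorm (a k • Z k) ^ 2 = a k ^ 2 * fnorm (Z k) ^ 2 := by
    rw [fnorm_sq, fnorm_sq, finner_smul_right, finner_comm, finner_smul_right]; ring
  rw [this]
  have h2 : a k ^ 2 ≤ c ^ 2 := sq_le_sq.2 (by rw [abs_of_nonneg hc]; exact ha k)
  exact mul_le_mul_of_nonneg_right h2 (sq_nonneg _)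

lemma best_ineq {n r : ℕ} {W X' X : Matrix (Fin n) (Fin n) ℝ} (h : IsBestRankApprox r W X')
    (hX : X.rank ≤ r) :
    finner (X' - X) (X' - X) ≤ 2 * finner (X' - X) (W - X) := by
  have h1 := h.2 X hX
  have h2 : fnorm (X' - W) ^ 2 ≤ fnorm (X - W) ^ 2 :=
    pow_le_pow_left₀ (Real.sqrt_nonneg _) h1 2
  rw [fnorm_sq, fnorm_sq] at h2
  have h3 : finner (X' - W) (X' - W) = finner (X' - X) (X' - X)
      - 2 * finner (X' - X) (W - X) + finner (X - W) (X - W) := by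
    simp only [finner_eq, Finset.mul_sum, ← Finset.sum_sub_distrib, ← Finset.sum_add_distrib]
    refine Finset.sum_congr rfl fun i _ => Finset.sum_congr rfl fun j _ => ?_
    simp only [Matrix.sub_apply]; ring
  linarith

lemma step {n m r s : ℕ} (A : Fin s → Fin m → Matrix (Fin n) (Fin n) ℝ)
    (δ₂ δ₃ : ℝ) (h0 : 0 ≤ δ₂) (hδ₂₃ : δ₂ ≤ δ₃) (hδ₃ : δ₃ < 1)
    (hARIP2 : ARIP (fun k => opA (A k)) (2 * r) δ₂)
    (hARIP3 : ARIP (fun k => opA (A k)) (3 * r) δ₃)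
    (X X0 X1 G : Fin s → Matrix (Fin n) (Fin n) ℝ) (hX : ∀ k, (X k).rank ≤ r)
    (hX0 : ∀ k, (X0 k).rank ≤ r)
    (e : Fin m → ℝ)
    (hG : ∀ k, G k = adjA (A k) (((∑ k, opA (A k) (X k)) + e) - ∑ j, opA (A j) (X0 j)))
    (α : Fin s → ℝ) (hα : ∀ k, |α k| ≤ 1 / (1 - δ₂)) (hα1 : ∀ k, |1 - α k| ≤ δ₂ / (1 - δ₂))
    (hNext : ∀ k, IsBestRankApprox r (X0 k + α k • G k) (X1 k)) :
    ‖toH (fun k => X1 k - X k)‖ ≤ (4 * δ₃ / (1 - δ₃)) * ‖toH (fun k => X0 k - X k)‖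
      + (2 * Real.sqrt (1 + δ₃) / (1 - δ₂)) * ‖toM e‖ := by
  set D : Fin s → Matrix (Fin n) (Fin n) ℝ := fun k => X1 k - X k with hD
  set E : Fin s → Matrix (Fin n) (Fin n) ℝ := fun k => X0 k - X k with hE
  set F : Fin s → Matrix (Fin n) (Fin n) ℝ := fun k => α k • D k with hF
  have p2 : 0 < 1 - δ₂ := by linarith
  have p3 : 0 < 1 - δ₃ := by linarith
  have h03 : 0 ≤ δ₃ := h0.trans hδ₂₃
  have hrank : ∀ a b : ℝ, ∀ k, (a • F k + b • E k).rank ≤ 3 * r := by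
    intro a b k
    have : a • F k + b • E k = (a * α k) • X1 k + b • X0 k + (-(a * α k) - b) • X k := by
      ext i j; simp [hF, hE, hD]; ring
    rw [this]
    have r1 := (rank_smul_le' (a * α k) (X1 k)).trans (hNext k).1
    have r2 := (rank_smul_le' b (X0 k)).trans (hX0 k)
    have r3 := (rank_smul_le' (-(a * α k) - b) (X k)).trans (hX k)
    have r4 := mrank_add_le ((a * α k) • X1 k + b • X0 k) ((-(a * α k) - b) • X k)
    have r5 := mrank_add_le ((a * α k) • X1 k) (b • X0 k)
    omega
  have hbil := bilin_rip A δ₃ h03 F E fun a b => arip_abs hARIP3 _ (hrank a b)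
  have hFn : ‖toH F‖ ≤ 1 / (1 - δ₂) * ‖toH D‖ := toH_mono _ (by positivity) α hα D
  have hDF : ‖toH (fun k => (1 - α k) • D k)‖ ≤ δ₂ / (1 - δ₂) * ‖toH D‖ :=
    toH_mono _ (by positivity) (fun k => 1 - α k) hα1 D
  have hDFeq : toH (fun k => (1 - α k) • D k) = toH D - toH F := by
    ext q; simp [toH, hF]; ring
  rw [hDFeq] at hDF
  have hLF : ‖bigL A F‖ ≤ Real.sqrt (1 + δ₃) * ‖toH F‖ := by
    have := arip_abs hARIP3 F (fun k => by simpa using hrank 1 0 k)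
    apply le_of_sq_le_sq _ (by positivity)
    rw [mul_pow, Real.sq_sqrt (by linarith)]
    have := (abs_le.1 this).2
    linarith
  have hmain : ‖toH D‖ ^ 2 ≤ 2 * (inner ℝ (toH D) (toH E)
      - inner ℝ (bigL A F) (bigL A E) + inner ℝ (bigL A F) (toM e)) := by
    have hv : toM (((∑ k, opA (A k) (X k)) + e) - ∑ j, opA (A j) (X0 j))
        = toM e - bigL A E := by
      have : bigL A E = (1:ℝ) • bigL A X0 + (-1:ℝ) • bigL A X := by
        rw [← bigL_comb]; congr 1; ext k i j; simp [hE]; ring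
      rw [this]
      ext p; simp [bigL, toM]; ring
    have h1 : inner ℝ (bigL A F) (toM e - bigL A E) = ∑ k, finner (F k) (G k) := by
      rw [← hv, bigL_inner]
      exact Finset.sum_congr rfl fun k _ => by rw [hG k]
    rw [inner_sub_right] at h1
    have h2 : ‖toH D‖ ^ 2 ≤ ∑ k, 2 * (finner (D k) (E k) + finner (F k) (G k)) := by
      rw [toH_norm_sq]
      refine Finset.sum_le_sum fun k _ => ?_
      rw [fnorm_sq]
      refine (best_ineq (hNext k) (hX k)).trans (le_of_eq ?_)
      have : X0 k + α k • G k - X k = E k + α k • G k := by simp only [hE]; abel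
      rw [this, finner_add_right, finner_smul_right, finner_comm (F k)]
      have h5 : finner (G k) (F k) = α k * finner (D k) (G k) := by
        rw [finner_comm (D k), ← finner_smul_right]
      rw [h5]
    rw [← Finset.mul_sum, Finset.sum_add_distrib, ← toH_inner, ← h1] at h2
    linarith
  have c1 : inner ℝ (toH D) (toH E) - inner ℝ (toH F) (toH E)
      ≤ δ₂ / (1 - δ₂) * ‖toH D‖ * ‖toH E‖ := by
    rw [← inner_sub_left]
    exact (real_inner_le_norm _ _).trans (mul_le_mul_of_nonneg_right hDF (norm_nonneg _))
  have c2 := (abs_le.1 hbil).1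
  have c3 : δ₃ * (‖toH F‖ * ‖toH E‖) ≤ δ₃ * (1 / (1 - δ₂) * ‖toH D‖ * ‖toH E‖) := by gcongr
  have c4 : inner ℝ (bigL A F) (toM e) ≤ Real.sqrt (1 + δ₃) * (1 / (1 - δ₂) * ‖toH D‖) * ‖toM e‖ := by
    refine (real_inner_le_norm _ _).trans (mul_le_mul_of_nonneg_right (hLF.trans ?_) (norm_nonneg _))
    gcongr
  have c5 : δ₂ / (1 - δ₂) + δ₃ * (1 / (1 - δ₂)) ≤ 2 * δ₃ / (1 - δ₃) := by
    have : δ₂ / (1 - δ₂) + δ₃ * (1 / (1 - δ₂)) = (δ₂ + δ₃) / (1 - δ₂) := by ring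
    rw [this]
    apply div_le_div₀ <;> linarith
  have c6 := mul_le_mul_of_nonneg_right c5 (mul_nonneg (norm_nonneg (toH D)) (norm_nonneg (toH E)))
  have fin : ‖toH D‖ * ‖toH D‖ ≤ ‖toH D‖ * ((4 * δ₃ / (1 - δ₃)) * ‖toH E‖
      + (2 * Real.sqrt (1 + δ₃) / (1 - δ₂)) * ‖toM e‖) := by
    have : ‖toH D‖ * ((4 * δ₃ / (1 - δ₃)) * ‖toH E‖
      + (2 * Real.sqrt (1 + δ₃) / (1 - δ₂)) * ‖toM e‖) =
      2 * (2 * δ₃ / (1 - δ₃) * (‖toH D‖ * ‖toH E‖)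
        + Real.sqrt (1 + δ₃) * (1 / (1 - δ₂) * ‖toH D‖) * ‖toM e‖) := by ring
    rw [this]
    linarith
  rcases (norm_nonneg (toH D)).eq_or_lt with h | h
  · rw [← h]; positivity
  · exact le_of_mul_le_mul_left fin h

/-- **Theorem 3 (IHT is robust to additive noise).** -/
theorem iht_noise
    {n m r s : ℕ}
    (A : Fin s → Fin m → Matrix (Fin n) (Fin n) ℝ)
    (δ₂ δ₃ : ℝ) (hδ₂₃ : δ₂ ≤ δ₃) (hδ₃ : δ₃ < 1)
    (hARIP2 : ARIP (fun k => opA (A k)) (2 * r) δ₂)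
    (hARIP3 : ARIP (fun k => opA (A k)) (3 * r) δ₃)
    (hγ : 4 * δ₃ / (1 - δ₃) < 1)
    (X : Fin s → Matrix (Fin n) (Fin n) ℝ) (hX : ∀ k, (X k).rank ≤ r)
    (e : Fin m → ℝ)
    (y : Fin m → ℝ) (hy : y = (∑ k, opA (A k) (X k)) + e)
    (Xl : ℕ → Fin s → Matrix (Fin n) (Fin n) ℝ)
    (U V : ℕ → Fin s → Matrix (Fin n) (Fin r) ℝ)
    (S : ℕ → Fin s → Matrix (Fin r) (Fin r) ℝ)
    (hU : ∀ l k, (U l k)ᵀ * U l k = 1) (hV : ∀ l k, (V l k)ᵀ * V l k = 1)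
    (hSdiag : ∀ l k i j, i ≠ j → S l k i j = 0) (hSpos : ∀ l k i, 0 < S l k i i)
    (hXl : ∀ l k, Xl l k = U l k * S l k * (V l k)ᵀ)
    (G : ℕ → Fin s → Matrix (Fin n) (Fin n) ℝ)
    (hG : ∀ l k, G l k = adjA (A k) (y - ∑ j, opA (A j) (Xl l j)))
    (hPt : ∀ l k, Pt (U l k) (V l k) (G l k) ≠ 0)
    (α : ℕ → Fin s → ℝ)
    (hα : ∀ l k, α l k = fnorm (Pt (U l k) (V l k) (G l k)) ^ 2 /
        enorm2 (opA (A k) (Pt (U l k) (V l k) (G l k))) ^ 2)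
    (hNext : ∀ l k, IsBestRankApprox r (Xl l k + α l k • G l k) (Xl (l + 1) k)) :
    ∀ l : ℕ,
      Real.sqrt (∑ k, fnorm (Xl l k - X k) ^ 2) ≤
        (4 * δ₃ / (1 - δ₃)) ^ l * Real.sqrt (∑ k, fnorm (Xl 0 k - X k) ^ 2) +
        (2 * Real.sqrt (1 + δ₃) / (1 - δ₂)) / (1 - 4 * δ₃ / (1 - δ₃)) * enorm2 e := by
  have q3 : 0 < 1 - δ₃ := by linarith
  have q2 : 0 < 1 - δ₂ := by linarith
  set γ := 4 * δ₃ / (1 - δ₃) with hγdef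
  have hg : 0 < 1 - γ := by linarith
  have hξ : 0 ≤ 2 * Real.sqrt (1 + δ₃) / (1 - δ₂) := by positivity
  have he : 0 ≤ enorm2 e := Real.sqrt_nonneg _
  intro l
  rcases Nat.eq_zero_or_pos s with hs | hs
  · subst hs
    simp
    positivity
  have k0 : Fin s := ⟨0, hs⟩
  have hδ₂ : 0 ≤ δ₂ := by
    have h1 := arip_single hARIP2 k0 _ (Pt_rank (U 0 k0) (V 0 k0) (G 0 k0))
    have h2 := fnorm_sq_pos (hPt 0 k0)
    by_contra hneg
    push Not at hneg
    nlinarith [h1.1.trans h1.2]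
  have hγ0 : 0 ≤ γ := by
    have : 0 ≤ δ₃ := hδ₂.trans hδ₂₃
    positivity
  have hstep : ∀ l, Real.sqrt (∑ k, fnorm (Xl (l+1) k - X k) ^ 2) ≤
      γ * Real.sqrt (∑ k, fnorm (Xl l k - X k) ^ 2) +
      2 * Real.sqrt (1 + δ₃) / (1 - δ₂) * enorm2 e := by
    intro l
    rw [← toH_norm, ← toH_norm, ← toM_norm]
    have hab : ∀ k, 1 / (1 + δ₂) ≤ α l k ∧ α l k ≤ 1 / (1 - δ₂) := by
      intro k
      obtain ⟨h1, h2⟩ := arip_single hARIP2 k _ (Pt_rank (U l k) (V l k) (G l k))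
      have h3 := fnorm_sq_pos (hPt l k)
      have h4 : 0 < enorm2 (opA (A k) (Pt (U l k) (V l k) (G l k))) ^ 2 :=
        lt_of_lt_of_le (by positivity) h1
      rw [hα l k]
      constructor
      · rw [div_le_div_iff₀ (by linarith) h4]; linarith
      · rw [div_le_div_iff₀ h4 q2]; linarith
    refine step A δ₂ δ₃ hδ₂ hδ₂₃ hδ₃ hARIP2 hARIP3 X (Xl l) (Xl (l+1)) (G l) hX ?_ e ?_ (α l)
      ?_ ?_ (hNext l)
    · intro k
      rw [hXl l k]
      exact (Matrix.rank_mul_le_right _ _).trans (Matrix.rank_le_height _)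
    · intro k; rw [hG l k, hy]
    · intro k
      have : 0 ≤ 1 / (1 + δ₂) := by positivity
      rw [abs_of_nonneg (this.trans (hab k).1)]
      exact (hab k).2
    · intro k
      have e1 : 1 / (1 - δ₂) = 1 + δ₂ / (1 - δ₂) := by field_simp; ring
      have e2 : 1 / (1 + δ₂) = 1 - δ₂ / (1 + δ₂) := by field_simp; ring
      have e3 : δ₂ / (1 + δ₂) ≤ δ₂ / (1 - δ₂) := by
        apply div_le_div_of_nonneg_left <;> linarith
      have := hab k
      rw [abs_le]
      constructor <;> linarith
  induction l with
  | zero => 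
    simp
    positivity
  | succ l ih =>
    refine (hstep l).trans ?_
    have h1 := mul_le_mul_of_nonneg_left ih hγ0
    have h2 : 2 * Real.sqrt (1 + δ₃) / (1 - δ₂) / (1 - γ) * enorm2 e =
      γ * (2 * Real.sqrt (1 + δ₃) / (1 - δ₂) / (1 - γ) * enorm2 e) +
      2 * Real.sqrt (1 + δ₃) / (1 - δ₂) * enorm2 e := by
      have : 2 * Real.sqrt (1 + δ₃) / (1 - δ₂) =
        (2 * Real.sqrt (1 + δ₃) / (1 - δ₂) / (1 - γ)) * (1 - γ) := by
        rw [div_mul_cancel₀ _ hg.ne']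
      generalize 2 * Real.sqrt (1 + δ₃) / (1 - δ₂) / (1 - γ) = w at *
      rw [this]; ring
    rw [pow_succ]
    linarith
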